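/- Let φ ∈ C_c^∞(ℝ^n) satisfy supp φ ⊂ Q and φ(ξ) = 1 for ξ ∈ 2^{-1}Q, set Φ(ξ,η) = φ(ξ)φ(η), and let A = (a_{μν})_{μ,ν∈ℤ^n} be an L^∞ matrix. Then for all finitely supported F, G, H : ℤ^n → ℂ with ‖F‖_{ℓ²} = ‖G‖_{ℓ²} = ‖H‖_{ℓ²} = 1, there exist Schwartz functions f, g on ℝ^n and a constant c ∈ (0,∞) depending only on n and φ such that c^{-1} ≤ ‖f‖_{L²} ≤ c, c^{-1} ≤ ‖g‖_{L²} ≤ c, and ‖T_{σ_{A,Φ}}(f,g)‖_{(L²,ℓ^∞)} ≥ c^{-1} |Σ_{μ,ν∈ℤ^n} a_{μν} F(μ)G(ν)H(μ+ν)|. -/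

import Mathlib

open MeasureTheory Complex
open scoped ENNReal NNReal

noncomputable section

abbrev Rn (n : ℕ) : Type := Fin n → ℝ
abbrev Zn (n : ℕ) : Type := Fin n → ℤ

/-- Coercion of a lattice point to a point of `ℝ^n`. -/
def coeZ {n : ℕ} (μ : Zn n) : Rn n := fun i => (μ i : ℝ)

/-- The cube `aQ = [-a/2, a/2]^n`. -/
def cube (n : ℕ) (a : ℝ) : Set (Rn n) := Set.univ.pi fun _ => Set.Icc (-a / 2) (a / 2)

/-- A smooth compactly supported function. -/
def IsCcInfty {E : Type*} [NormedAddCommGroup E] [NormedSpace ℝ E] (Φ : E → ℂ) : Prop :=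
  ContDiff ℝ (⊤ : ℕ∞) Φ ∧ HasCompactSupport Φ

/-- The Fourier transform of a Schwartz function. -/
def ft {n : ℕ} (f : SchwartzMap (Rn n) ℂ) (ξ : Rn n) : ℂ :=
  ∫ x : Rn n, Complex.exp ((-2 * Real.pi * Complex.I) * ((∑ i, x i * ξ i : ℝ) : ℂ)) * f x

/-- The bilinear Fourier multiplier operator `T_σ(f,g)`. -/
def Tbil {n : ℕ} (σ : Rn n × Rn n → ℂ) (f g : SchwartzMap (Rn n) ℂ) (x : Rn n) : ℂ :=
  ∫ p : Rn n × Rn n,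
    Complex.exp ((2 * Real.pi * Complex.I) * ((∑ i, x i * (p.1 i + p.2 i) : ℝ) : ℂ)) *
      σ p * ft f p.1 * ft g p.2

/-- `L²` norm of `h(·+ν)` on the unit cube `Q`. -/
def localL2 {n : ℕ} (h : Rn n → ℂ) (ν : Zn n) : ℝ≥0∞ :=
  (∫⁻ x in cube n 1, (‖h (x + coeZ ν)‖₊ : ℝ≥0∞) ^ 2) ^ (1 / 2 : ℝ)

/-- The amalgam `(L², ℓ^q)` norm. -/
def amalgamNorm {n : ℕ} (q : ℝ≥0∞) (h : Rn n → ℂ) : ℝ≥0∞ :=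
  if q = ∞ then ⨆ ν : Zn n, localL2 h ν
  else (∑' ν : Zn n, localL2 h ν ^ q.toReal) ^ (1 / q.toReal)

/-- The multiplier norm `‖σ‖_{M(L²×L² → (L²,ℓ^q))}`. -/
def multNorm {n : ℕ} (q : ℝ≥0∞) (σ : Rn n × Rn n → ℂ) : ℝ≥0∞ :=
  ⨆ (f : SchwartzMap (Rn n) ℂ) (g : SchwartzMap (Rn n) ℂ)
    (_ : eLpNorm (⇑f) 2 volume = 1) (_ : eLpNorm (⇑g) 2 volume = 1),
    amalgamNorm q (Tbil σ f g)

/-- An `L^∞` matrix on `ℤ^n × ℤ^n`. -/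
def IsLinftyMatrix {n : ℕ} (A : Zn n → Zn n → ℂ) : Prop :=
  ∃ C : ℝ, ∀ μ ν, ‖A μ ν‖ ≤ C

/-- The norm `‖A‖_B`: the trilinear form norm over finitely supported unit `ℓ²` vectors. -/
def normB {n : ℕ} (A : Zn n → Zn n → ℂ) : ℝ≥0∞ :=
  ⨆ (F : Zn n →₀ ℂ) (G : Zn n →₀ ℂ) (H : Zn n →₀ ℂ)
    (_ : ∑ μ ∈ F.support, ‖F μ‖ ^ 2 = 1)
    (_ : ∑ ν ∈ G.support, ‖G ν‖ ^ 2 = 1)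
    (_ : ∑ ρ ∈ H.support, ‖H ρ‖ ^ 2 = 1),
    (‖∑ μ ∈ F.support, ∑ ν ∈ G.support, A μ ν * F μ * G ν * H (μ + ν)‖₊ : ℝ≥0∞)

/-- The multiplier `σ_{A,Φ}(ξ,η) = Σ_{μ,ν} a_{μν} Φ(ξ-μ, η-ν)`. -/
def sigmaA {n : ℕ} (A : Zn n → Zn n → ℂ) (Φ : Rn n × Rn n → ℂ) (p : Rn n × Rn n) : ℂ :=
  ∑' μν : Zn n × Zn n, A μν.1 μν.2 * Φ (p.1 - coeZ μν.1, p.2 - coeZ μν.2)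

/-- Condition (A) for functions on `ℝ^d`. -/
def ConditionA {d : ℕ} (Φ : Rn d → ℂ) : Prop :=
  ∃ Θ : Rn d → ℂ, ContDiff ℝ (⊤ : ℕ∞) Θ ∧ HasCompactSupport Θ ∧
    ∀ α : Zn d, (∫ x : Rn d, Θ x * Φ (x - coeZ α)) = if α = 0 then 1 else 0

/-- Condition (A) for functions on `ℝ^n × ℝ^n` (i.e. `d = 2n`). -/
def ConditionA2 {n : ℕ} (Φ : Rn n × Rn n → ℂ) : Prop :=
  ∃ Θ : Rn n × Rn n → ℂ, ContDiff ℝ (⊤ : ℕ∞) Θ ∧ HasCompactSupport Θ ∧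
    ∀ α β : Zn n, (∫ p : Rn n × Rn n, Θ p * Φ (p.1 - coeZ α, p.2 - coeZ β)) =
      if α = 0 ∧ β = 0 then 1 else 0

/-- Condition (A) for functions on `ℝ` (the case `d = 1`). -/
def ConditionA1 (Φ : ℝ → ℂ) : Prop :=
  ∃ θ : ℝ → ℂ, ContDiff ℝ (⊤ : ℕ∞) θ ∧ HasCompactSupport θ ∧
    ∀ j : ℤ, (∫ x : ℝ, θ x * Φ (x - (j : ℝ))) = if j = 0 then 1 else 0

/-- The `L^∞` (sup) norm, valued in `ℝ≥0∞`. -/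
def supNorm {E : Type*} (u : E → ℂ) : ℝ≥0∞ := ⨆ x, (‖u x‖₊ : ℝ≥0∞)

end


/-- The character `x ↦ e^{2πi x·ξ}`. -/
noncomputable def chr {n : ℕ} (ξ x : Rn n) : ℂ :=
  Complex.exp ((2 * Real.pi * Complex.I) * ((∑ i, x i * ξ i : ℝ) : ℂ))

lemma chr_add {n : ℕ} (ξ η x : Rn n) : chr (ξ + η) x = chr ξ x * chr η x := by
  simp only [chr, ← Complex.exp_add, Pi.add_apply, mul_add, Finset.sum_add_distrib, ofReal_add]

lemma norm_chr {n : ℕ} (ξ x : Rn n) : ‖chr ξ x‖ = 1 := by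
  rw [chr, show (2 * Real.pi * Complex.I) * ((∑ i, x i * ξ i : ℝ) : ℂ)
    = ((2 * Real.pi * ∑ i, x i * ξ i : ℝ) : ℂ) * Complex.I by push_cast; ring]
  exact Complex.norm_exp_ofReal_mul_I _

lemma re_chr {n : ℕ} (ξ x : Rn n) : (chr ξ x).re = Real.cos (2 * Real.pi * ∑ i, x i * ξ i) := by
  rw [chr, show (2 * Real.pi * Complex.I) * ((∑ i, x i * ξ i : ℝ) : ℂ)
    = ((2 * Real.pi * ∑ i, x i * ξ i : ℝ) : ℂ) * Complex.I by push_cast; ring]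
  exact Complex.exp_ofReal_mul_I_re _

lemma continuous_chr_left {n : ℕ} (x : Rn n) : Continuous fun ξ => chr ξ x := by
  unfold chr; fun_prop

lemma continuous_chr {n : ℕ} (ξ : Rn n) : Continuous (chr ξ) := by
  unfold chr; fun_prop

lemma conj_chr {n : ℕ} (ξ x : Rn n) : (starRingEnd ℂ) (chr ξ x) = chr (-ξ) x := by
  simp [chr, ← Complex.exp_conj, Complex.conj_ofNat]

lemma coeZ_zero {n : ℕ} : coeZ (0 : Zn n) = 0 := by
  ext i; simp [coeZ]

lemma coeZ_neg {n : ℕ} (μ : Zn n) : coeZ (-μ) = -coeZ μ := by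
  ext i; simp [coeZ]

lemma coeZ_add {n : ℕ} (μ ν : Zn n) : coeZ (μ + ν) = coeZ μ + coeZ ν := by
  ext i; simp [coeZ]

lemma eLpNorm_fourier_schwartz {V : Type*} [NormedAddCommGroup V] [InnerProductSpace ℝ V]
    [FiniteDimensional ℝ V] [MeasurableSpace V] [BorelSpace V] (f : SchwartzMap V ℂ) :
    eLpNorm (⇑(FourierTransform.fourier f)) 2 volume = eLpNorm (⇑f) 2 volume := by
  have h := SchwartzMap.norm_fourier_toL2_eq f
  rw [SchwartzMap.norm_toLp, SchwartzMap.norm_toLp] at h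
  have h1 := ((FourierTransform.fourier f).memLp 2 volume).eLpNorm_ne_top
  have h2 := (f.memLp 2 volume).eLpNorm_ne_top
  rw [← ENNReal.ofReal_toReal h1, ← ENNReal.ofReal_toReal h2, h]

/-- Every Schwartz function is the Fourier transform of a Schwartz function with the same
`L²` norm. -/
lemma exists_ft_eq {n : ℕ} (Ψ : SchwartzMap (Rn n) ℂ) :
    ∃ f : SchwartzMap (Rn n) ℂ, (∀ ξ, ft f ξ = Ψ ξ) ∧
      eLpNorm (⇑f) 2 volume = eLpNorm (⇑Ψ) 2 volume := by
  let e : EuclideanSpace ℝ (Fin n) ≃L[ℝ] Rn n := EuclideanSpace.equiv (Fin n) ℝ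
  have he : MeasurePreserving e.symm := PiLp.volume_preserving_toLp (Fin n)
  have he' : MeasurePreserving e := PiLp.volume_preserving_ofLp (Fin n)
  let Ψ' : SchwartzMap (EuclideanSpace ℝ (Fin n)) ℂ :=
    SchwartzMap.compCLMOfContinuousLinearEquiv ℂ e Ψ
  let f' : SchwartzMap (EuclideanSpace ℝ (Fin n)) ℂ := FourierTransformInv.fourierInv Ψ'
  have hf' : FourierTransform.fourier f' = Ψ' := FourierTransform.fourier_fourierInv_eq Ψ'
  refine ⟨SchwartzMap.compCLMOfContinuousLinearEquiv ℂ e.symm f', fun ξ => ?_, ?_⟩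
  · have h1 : Ψ ξ = (FourierTransform.fourier f') (e.symm ξ) := by
      rw [hf']; simp [Ψ']
    rw [h1, SchwartzMap.fourier_coe, Real.fourier_eq',
      ← he.integral_comp e.symm.toHomeomorph.measurableEmbedding, ft]
    refine integral_congr_ae (Filter.Eventually.of_forall fun x => ?_)
    simp only [SchwartzMap.compCLMOfContinuousLinearEquiv_apply, Function.comp_apply, smul_eq_mul]
    congr 2
    simp [e, PiLp.inner_apply, mul_comm]
    ring
  · have h2 : eLpNorm (⇑f') 2 volume = eLpNorm (⇑Ψ') 2 volume := by
      rw [← hf', eLpNorm_fourier_schwartz]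
    rw [SchwartzMap.compCLMOfContinuousLinearEquiv_apply,
      eLpNorm_comp_measurePreserving f'.continuous.aestronglyMeasurable he, h2,
      SchwartzMap.compCLMOfContinuousLinearEquiv_apply,
      eLpNorm_comp_measurePreserving Ψ.continuous.aestronglyMeasurable he']

/-- The linear combination `∑_μ F(μ) ψ(· - μ)` of integer translates. -/
noncomputable def comb {n : ℕ} (ψ : Rn n → ℝ) (F : Zn n →₀ ℂ) (ξ : Rn n) : ℂ :=
  ∑ μ ∈ F.support, F μ * (ψ (ξ - coeZ μ) : ℂ)

lemma contDiff_comb {n : ℕ} {ψ : Rn n → ℝ} (hψ : ContDiff ℝ (⊤ : ℕ∞) ψ) (F : Zn n →₀ ℂ) :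
    ContDiff ℝ (⊤ : ℕ∞) (comb ψ F) := by
  unfold comb
  refine ContDiff.sum fun μ _ => contDiff_const.mul ?_
  exact Complex.ofRealCLM.contDiff.comp (hψ.comp (contDiff_id.sub contDiff_const))

lemma hasCompactSupport_comb {n : ℕ} {ψ : Rn n → ℝ} (hψ : HasCompactSupport ψ) (F : Zn n →₀ ℂ) :
    HasCompactSupport (comb ψ F) := by
  have h : ∀ s : Finset (Zn n),
      HasCompactSupport fun ξ => ∑ μ ∈ s, F μ * (ψ (ξ - coeZ μ) : ℂ) := by
    intro s
    induction s using Finset.induction_on with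
    | empty => simpa [Pi.zero_def] using
        (HasCompactSupport.zero : HasCompactSupport (0 : Rn n → ℂ))
    | insert a s ha ih =>
      simp only [Finset.sum_insert ha]
      have h0 : HasCompactSupport fun ξ => ψ (ξ - coeZ a) := by
        simpa [Function.comp_def, sub_eq_add_neg] using
          hψ.comp_homeomorph (Homeomorph.addRight (-coeZ a))
      have h1 : HasCompactSupport fun ξ => (ψ (ξ - coeZ a) : ℂ) :=
        h0.comp_left (g := fun t : ℝ => (t : ℂ)) ofReal_zero
      exact (h1.mul_left (f := fun _ => F a)).add ih
  exact h _

lemma abs_sub_lt_of_ne_zero {n : ℕ} {ψ : Rn n → ℝ}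
    (hs : Function.support ψ ⊆ Metric.ball 0 (1 / 4)) {ξ : Rn n} (h : ψ ξ ≠ 0) (i : Fin n) :
    |ξ i| < 1 / 4 := by
  have h1 : ‖ξ‖ < 1 / 4 := by simpa using hs h
  exact (norm_le_pi_norm ξ i).trans_lt h1

lemma exists_one_le_abs_sub {n : ℕ} {μ ν : Zn n} (h : μ ≠ ν) :
    ∃ i, (1 : ℝ) ≤ |coeZ μ i - coeZ ν i| := by
  obtain ⟨i, hi⟩ := Function.ne_iff.1 h
  refine ⟨i, ?_⟩
  have h1 : (1 : ℤ) ≤ |μ i - ν i| := Int.one_le_abs (sub_ne_zero.2 hi)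
  simpa [coeZ] using (by exact_mod_cast h1 : (1 : ℝ) ≤ |((μ i : ℝ) - (ν i : ℝ))|)

lemma eq_zero_of_ne_zero_translate {n : ℕ} {ψ : Rn n → ℝ}
    (hs : Function.support ψ ⊆ Metric.ball 0 (1 / 4)) {ξ : Rn n} {μ ν : Zn n}
    (h : ψ (ξ - coeZ μ) ≠ 0) {φ : Rn n → ℂ} (hsupp : Function.support φ ⊆ cube n 1)
    (hne : ν ≠ μ) : φ (ξ - coeZ ν) = 0 := by
  by_contra hc
  obtain ⟨i, hi⟩ := exists_one_le_abs_sub hne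
  have h1 := abs_sub_lt_of_ne_zero hs h i
  have h2 := (Set.mem_univ_pi.1 (hsupp hc)) i
  simp only [Pi.sub_apply, Set.mem_Icc, abs_lt] at h1 h2
  rcases le_abs.1 hi with h3 | h3 <;> linarith

lemma support_ofReal_subset_cube {n : ℕ} {ψ : Rn n → ℝ}
    (hs : Function.support ψ ⊆ Metric.ball 0 (1 / 4)) :
    Function.support (fun ξ => (ψ ξ : ℂ)) ⊆ cube n 1 := by
  intro ξ hξ
  refine Set.mem_univ_pi.2 fun i => ?_
  have h := abs_lt.1 (abs_sub_lt_of_ne_zero hs (ξ := ξ) (by simpa using hξ) i)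
  exact ⟨by linarith [h.1], by linarith [h.2]⟩

lemma enorm_comb_sq {n : ℕ} {ψ : Rn n → ℝ}
    (hs : Function.support ψ ⊆ Metric.ball 0 (1 / 4)) (F : Zn n →₀ ℂ) (ξ : Rn n) :
    ‖comb ψ F ξ‖ₑ ^ 2 = ∑ μ ∈ F.support, ‖F μ‖ₑ ^ 2 * ‖ψ (ξ - coeZ μ)‖ₑ ^ 2 := by
  unfold comb
  by_cases h : ∃ μ ∈ F.support, ψ (ξ - coeZ μ) ≠ 0
  · obtain ⟨μ, hμ, h⟩ := h
    have hz : ∀ ν, ν ≠ μ → ψ (ξ - coeZ ν) = 0 := fun ν hν => by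
      simpa using eq_zero_of_ne_zero_translate hs h (support_ofReal_subset_cube hs) hν
    rw [Finset.sum_eq_single_of_mem μ hμ (fun ν _ hν => by simp [hz ν hν]),
      Finset.sum_eq_single_of_mem μ hμ (fun ν _ hν => by simp [hz ν hν]), enorm_mul, mul_pow]
    simp [enorm_eq_nnnorm]
  · push Not at h
    rw [Finset.sum_eq_zero (fun ν hν => by simp [h ν hν]),
      Finset.sum_eq_zero (fun ν hν => by simp [h ν hν])]
    simp

lemma eLpNorm_two_eq {n : ℕ} {E : Type*} [NormedAddCommGroup E] (u : Rn n → E) :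
    eLpNorm u 2 volume = (∫⁻ x, ‖u x‖ₑ ^ 2) ^ (1 / 2 : ℝ) := by
  rw [eLpNorm_eq_lintegral_rpow_enorm_toReal (by simp) (by simp)]
  simp

lemma sum_enorm_sq {n : ℕ} {F : Zn n →₀ ℂ} (hF : ∑ μ ∈ F.support, ‖F μ‖ ^ 2 = 1) :
    ∑ μ ∈ F.support, ‖F μ‖ₑ ^ 2 = 1 := by
  have h : ∀ μ, ‖F μ‖ₑ ^ 2 = ENNReal.ofReal (‖F μ‖ ^ 2) := fun μ => by
    rw [ENNReal.ofReal_pow (norm_nonneg _), ofReal_norm]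
  simp only [h]
  rw [← ENNReal.ofReal_sum_of_nonneg (fun _ _ => by positivity), hF, ENNReal.ofReal_one]

lemma eLpNorm_comb {n : ℕ} {ψ : Rn n → ℝ} (hc : Continuous ψ)
    (hs : Function.support ψ ⊆ Metric.ball 0 (1 / 4)) {F : Zn n →₀ ℂ}
    (hF : ∑ μ ∈ F.support, ‖F μ‖ ^ 2 = 1) :
    eLpNorm (comb ψ F) 2 volume = eLpNorm ψ 2 volume := by
  have hm : Measurable ψ := hc.measurable
  rw [eLpNorm_two_eq, eLpNorm_two_eq]
  congr 1
  simp only [enorm_comb_sq hs]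
  rw [lintegral_finsetSum _ (fun μ _ => by fun_prop)]
  have h : ∀ μ : Zn n, ∫⁻ ξ, ‖F μ‖ₑ ^ 2 * ‖ψ (ξ - coeZ μ)‖ₑ ^ 2
      = ‖F μ‖ₑ ^ 2 * ∫⁻ ξ, ‖ψ ξ‖ₑ ^ 2 := fun μ => by
    rw [lintegral_const_mul _ (by fun_prop),
      lintegral_sub_right_eq_self (fun ξ => ‖ψ ξ‖ₑ ^ 2) (coeZ μ)]
  simp only [h]
  rw [← Finset.sum_mul, sum_enorm_sq hF, one_mul]

/-- The symbol `σ_{A,φ⊗φ}` acts on translated bumps by multiplication with the entries of `A`. -/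
lemma sigmaA_mul_bump {n : ℕ} {φ : Rn n → ℂ} (hsupp : Function.support φ ⊆ cube n 1)
    (hone : ∀ ξ ∈ cube n (1 / 2), φ ξ = 1) {ψ : Rn n → ℝ}
    (hs : Function.support ψ ⊆ Metric.ball 0 (1 / 4)) (A : Zn n → Zn n → ℂ) (p : Rn n × Rn n)
    (μ ν : Zn n) :
    sigmaA A (fun p : Rn n × Rn n => φ p.1 * φ p.2) p *
        ((ψ (p.1 - coeZ μ) : ℂ) * (ψ (p.2 - coeZ ν) : ℂ)) =
      A μ ν * ((ψ (p.1 - coeZ μ) : ℂ) * (ψ (p.2 - coeZ ν) : ℂ)) := by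
  by_cases h1 : ψ (p.1 - coeZ μ) = 0
  · simp [h1]
  by_cases h2 : ψ (p.2 - coeZ ν) = 0
  · simp [h2]
  have key : ∀ ξ : Rn n, ψ ξ ≠ 0 → φ ξ = 1 := fun ξ hξ => by
    refine hone ξ (Set.mem_univ_pi.2 fun i => ?_)
    have h := abs_lt.1 (abs_sub_lt_of_ne_zero hs hξ i)
    exact ⟨by linarith [h.1], by linarith [h.2]⟩
  congr 1
  rw [sigmaA, tsum_eq_single (μ, ν)]
  · simp [key _ h1, key _ h2]
  · rintro ⟨μ', ν'⟩ hne
    by_cases hμ : μ' = μ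
    · have hν : ν' ≠ ν := fun h => hne (by rw [hμ, h])
      simp [eq_zero_of_ne_zero_translate hs h2 hsupp hν]
    · simp [eq_zero_of_ne_zero_translate hs h1 hsupp hμ]

/-- The inverse Fourier transform of `ψ`. -/
noncomputable def theta {n : ℕ} (ψ : Rn n → ℝ) (x : Rn n) : ℂ :=
  ∫ ξ : Rn n, chr ξ x * (ψ ξ : ℂ)

lemma integral_chr_mul_translate {n : ℕ} (ψ : Rn n → ℝ) (x : Rn n) (μ : Zn n) :
    ∫ ξ : Rn n, chr ξ x * (ψ (ξ - coeZ μ) : ℂ) = chr (coeZ μ) x * theta ψ x := by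
  rw [theta, ← integral_const_mul,
    ← integral_sub_right_eq_self (fun ξ => chr (coeZ μ) x * (chr ξ x * (ψ ξ : ℂ))) (coeZ μ)]
  congr 1
  ext ξ
  rw [← mul_assoc, ← chr_add, add_sub_cancel]

lemma integrable_chr_mul_translate {n : ℕ} {ψ : Rn n → ℝ} (hc : Continuous ψ)
    (hcs : HasCompactSupport ψ) (x : Rn n) (μ : Zn n) :
    Integrable fun ξ : Rn n => chr ξ x * (ψ (ξ - coeZ μ) : ℂ) := by
  have h : Integrable fun ξ : Rn n => ((ψ (ξ - coeZ μ) : ℝ) : ℂ) :=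
    ((hc.integrable_of_hasCompactSupport hcs).comp_sub_right (coeZ μ)).ofReal
  exact h.bdd_mul (c := 1) (continuous_chr_left x).aestronglyMeasurable
    (Filter.Eventually.of_forall fun ξ => (norm_chr ξ x).le)

lemma Tbil_eq {n : ℕ} {φ : Rn n → ℂ} (hsupp : Function.support φ ⊆ cube n 1)
    (hone : ∀ ξ ∈ cube n (1 / 2), φ ξ = 1) {ψ : Rn n → ℝ} (hc : Continuous ψ)
    (hcs : HasCompactSupport ψ) (hs : Function.support ψ ⊆ Metric.ball 0 (1 / 4))
    (A : Zn n → Zn n → ℂ) {F G : Zn n →₀ ℂ} {f g : SchwartzMap (Rn n) ℂ}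
    (hf : ∀ ξ, ft f ξ = comb ψ F ξ) (hg : ∀ ξ, ft g ξ = comb ψ G ξ) (x : Rn n) :
    Tbil (sigmaA A (fun p : Rn n × Rn n => φ p.1 * φ p.2)) f g x =
      theta ψ x ^ 2 * ∑ μ ∈ F.support, ∑ ν ∈ G.support,
        A μ ν * F μ * G ν * chr (coeZ (μ + ν)) x := by
  have h : ∀ p : Rn n × Rn n,
      Complex.exp ((2 * Real.pi * Complex.I) * ((∑ i, x i * (p.1 i + p.2 i) : ℝ) : ℂ)) *
        sigmaA A (fun p : Rn n × Rn n => φ p.1 * φ p.2) p * ft f p.1 * ft g p.2 =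
      ∑ μ ∈ F.support, ∑ ν ∈ G.support, A μ ν * F μ * G ν *
        ((chr p.1 x * (ψ (p.1 - coeZ μ) : ℂ)) * (chr p.2 x * (ψ (p.2 - coeZ ν) : ℂ))) := by
    intro p
    have h0 : Complex.exp ((2 * Real.pi * Complex.I) * ((∑ i, x i * (p.1 i + p.2 i) : ℝ) : ℂ))
        = chr p.1 x * chr p.2 x := by rw [← chr_add]; rfl
    rw [h0, hf, hg, comb, comb, mul_assoc, Finset.sum_mul_sum, Finset.mul_sum]
    refine Finset.sum_congr rfl fun μ _ => ?_
    rw [Finset.mul_sum]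
    refine Finset.sum_congr rfl fun ν _ => ?_
    linear_combination (chr p.1 x * chr p.2 x * F μ * G ν) *
      sigmaA_mul_bump hsupp hone hs A p μ ν
  have hint : ∀ μ ν : Zn n, Integrable fun p : Rn n × Rn n => A μ ν * F μ * G ν *
        ((chr p.1 x * (ψ (p.1 - coeZ μ) : ℂ)) * (chr p.2 x * (ψ (p.2 - coeZ ν) : ℂ))) :=
    fun μ ν => ((integrable_chr_mul_translate hc hcs x μ).mul_prod
      (integrable_chr_mul_translate hc hcs x ν)).const_mul _
  rw [Tbil]
  simp only [h]
  rw [integral_finsetSum _ fun μ _ => integrable_finsetSum _ fun ν _ => hint μ ν, Finset.mul_sum]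
  refine Finset.sum_congr rfl fun μ _ => ?_
  rw [integral_finsetSum _ fun ν _ => hint μ ν, Finset.mul_sum]
  refine Finset.sum_congr rfl fun ν _ => ?_
  rw [integral_const_mul, Measure.volume_eq_prod,
    integral_prod_mul (fun ξ : Rn n => chr ξ x * (ψ (ξ - coeZ μ) : ℂ))
      (fun η : Rn n => chr η x * (ψ (η - coeZ ν) : ℂ)),
    integral_chr_mul_translate, integral_chr_mul_translate, coeZ_add, chr_add]
  ring

/-- A bump function with support so small that its Fourier transform does not vanish on the
unit cube. -/
lemma exists_bump (n : ℕ) : ∃ ψ : Rn n → ℝ, ContDiff ℝ (⊤ : ℕ∞) ψ ∧ HasCompactSupport ψ ∧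
    Function.support ψ ⊆ Metric.ball 0 (1 / 4) ∧ 0 < ∫ ξ, ψ ξ ∧
    ∀ x ∈ cube n 1, (∫ ξ, ψ ξ) / 2 ≤ ‖theta ψ x‖ := by
  have hr : (0 : ℝ) < 1 / (4 * (n + 1)) := by positivity
  let b : ContDiffBump (0 : Rn n) := ⟨1 / (4 * (n + 1)) / 2, 1 / (4 * (n + 1)), half_pos hr,
    half_lt_self hr⟩
  have hbi : Integrable (b : Rn n → ℝ) := b.integrable
  refine ⟨b, b.contDiff, b.hasCompactSupport, ?_, b.integral_pos, fun x hx => ?_⟩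
  · rw [b.support_eq]
    refine Metric.ball_subset_ball ?_
    change (1 : ℝ) / (4 * (n + 1)) ≤ 1 / 4
    exact one_div_le_one_div_of_le (by norm_num) (by nlinarith [n.cast_nonneg (α := ℝ)])
  · have hi : Integrable fun ξ : Rn n => chr ξ x * (b ξ : ℂ) := by
      simpa [coeZ_zero] using
        integrable_chr_mul_translate b.continuous b.hasCompactSupport x 0
    refine le_trans ?_ (Complex.re_le_norm _)
    have hre : (theta b x).re = ∫ ξ, (chr ξ x * (b ξ : ℂ)).re := by
      rw [theta]; exact (integral_re hi).symm
    rw [hre, ← integral_div]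
    refine integral_mono (hbi.div_const 2) hi.re fun ξ => ?_
    change b ξ / 2 ≤ (chr ξ x * (b ξ : ℂ)).re
    rw [Complex.re_mul_ofReal, re_chr]
    by_cases hξ : b ξ = 0
    · simp [hξ]
    have hξ' : ‖ξ‖ < 1 / (4 * (n + 1)) := by
      have : ξ ∈ Function.support b := hξ
      rw [b.support_eq] at this
      exact mem_ball_zero_iff.1 this
    have hsum : |∑ i, x i * ξ i| ≤ 1 / 8 := by
      calc |∑ i, x i * ξ i| ≤ ∑ i : Fin n, |x i * ξ i| := Finset.abs_sum_le_sum_abs _ _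
        _ ≤ ∑ i : Fin n, 1 / 2 * (1 / (4 * (n + 1) : ℝ)) := by
            refine Finset.sum_le_sum fun i _ => ?_
            rw [abs_mul]
            have h1 := (Set.mem_univ_pi.1 hx) i
            exact mul_le_mul (abs_le.2 ⟨by linarith [h1.1], h1.2⟩)
              ((norm_le_pi_norm ξ i).trans hξ'.le) (abs_nonneg _) (by norm_num)
        _ = n / (8 * (n + 1)) := by
            rw [Finset.sum_const, Finset.card_univ, Fintype.card_fin, nsmul_eq_mul]
            field_simp; ring
        _ ≤ 1 / 8 := by
            rw [div_le_div_iff₀ (by positivity) (by norm_num)]; linarith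
    have hcos : (1 : ℝ) / 2 ≤ Real.cos (2 * Real.pi * ∑ i, x i * ξ i) := by
      rw [← Real.cos_pi_div_three, ← Real.cos_abs (2 * Real.pi * _)]
      have hpi := Real.pi_pos
      have habs : |2 * Real.pi * ∑ i, x i * ξ i| ≤ Real.pi / 3 := by
        rw [abs_mul, abs_of_pos (by positivity)]
        nlinarith
      exact Real.cos_le_cos_of_nonneg_of_le_pi (abs_nonneg _) (by linarith) habs
    nlinarith [b.nonneg (x := ξ)]

lemma integral_Icc_exp (k : ℤ) :
    ∫ t in Set.Icc (-1 / 2 : ℝ) (1 / 2), Complex.exp (2 * Real.pi * Complex.I * k * t) =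
      if k = 0 then 1 else 0 := by
  rw [integral_Icc_eq_integral_Ioc, ← intervalIntegral.integral_of_le (by norm_num)]
  split_ifs with hk
  · subst hk; norm_num
  · have hc : (2 * Real.pi * Complex.I * k : ℂ) ≠ 0 := by
      simp [Real.pi_ne_zero, Complex.I_ne_zero, hk]
    rw [integral_exp_mul_complex hc, div_eq_zero_iff]
    left
    rw [sub_eq_zero, Complex.exp_eq_exp_iff_exists_int]
    exact ⟨k, by push_cast; ring⟩

lemma integral_cube_chr {n : ℕ} (m : Zn n) :
    ∫ x in cube n 1, chr (coeZ m) x = if m = 0 then 1 else 0 := by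
  have h : ∀ x : Rn n, chr (coeZ m) x =
      ∏ i, Complex.exp (2 * Real.pi * Complex.I * (m i) * (x i)) := fun x => by
    rw [chr, ← Complex.exp_sum]
    congr 1
    push_cast
    rw [Finset.mul_sum]
    exact Finset.sum_congr rfl fun i _ => by simp [coeZ]; ring
  simp only [h]
  rw [cube, volume_pi, Measure.restrict_pi_pi,
    integral_fintype_prod_eq_prod (fun i (t : ℝ) =>
      Complex.exp (2 * Real.pi * Complex.I * (m i) * t))]
  simp only [integral_Icc_exp]
  split_ifs with hm
  · simp [hm]
  · obtain ⟨i, hi⟩ := Function.ne_iff.1 hm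
    exact Finset.prod_eq_zero (Finset.mem_univ i) (by simpa using hi)

lemma integrableOn_chr {n : ℕ} (ξ : Rn n) : IntegrableOn (chr ξ) (cube n 1) :=
  (continuous_chr ξ).continuousOn.integrableOn_compact (isCompact_univ_pi fun _ => isCompact_Icc)

lemma lintegral_cube_trig_sq {n : ℕ} {H : Zn n →₀ ℂ} (hH : ∑ ρ ∈ H.support, ‖H ρ‖ ^ 2 = 1) :
    ∫⁻ x in cube n 1, ‖∑ ρ ∈ H.support, H ρ * chr (coeZ (-ρ)) x‖ₑ ^ 2 = 1 := by
  set K : Rn n → ℂ := fun x => ∑ ρ ∈ H.support, H ρ * chr (coeZ (-ρ)) x with hK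
  have hKc : Continuous K :=
    continuous_finsetSum _ fun ρ _ => continuous_const.mul (continuous_chr _)
  have hint : IntegrableOn (fun x => ‖K x‖ ^ 2) (cube n 1) :=
    (hKc.norm.pow 2).continuousOn.integrableOn_compact
      (isCompact_univ_pi fun _ => isCompact_Icc)
  have hexp : ∀ x, ((‖K x‖ ^ 2 : ℝ) : ℂ) = ∑ ρ ∈ H.support, ∑ τ ∈ H.support,
      H ρ * (starRingEnd ℂ) (H τ) * chr (coeZ (τ - ρ)) x := by
    intro x
    rw [ofReal_pow, ← Complex.mul_conj', hK]
    simp only [map_sum, map_mul, Finset.sum_mul_sum]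
    refine Finset.sum_congr rfl fun ρ _ => Finset.sum_congr rfl fun τ _ => ?_
    rw [conj_chr, coeZ_neg τ, neg_neg, sub_eq_add_neg, coeZ_add, chr_add]
    ring
  have hval : ∫ x in cube n 1, ‖K x‖ ^ 2 = 1 := by
    have hC : ((∫ x in cube n 1, ‖K x‖ ^ 2 : ℝ) : ℂ) = 1 := by
      rw [← integral_complex_ofReal]
      simp only [hexp]
      rw [integral_finsetSum _ fun ρ _ => integrable_finsetSum _ fun τ _ =>
        (integrableOn_chr _).const_mul _]
      rw [show (1 : ℂ) = ∑ ρ ∈ H.support, ((‖H ρ‖ ^ 2 : ℝ) : ℂ) by rw [← ofReal_sum, hH, ofReal_one]]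
      refine Finset.sum_congr rfl fun ρ hρ => ?_
      rw [integral_finsetSum _ fun τ _ => (integrableOn_chr _).const_mul _]
      simp only [integral_const_mul, integral_cube_chr]
      rw [Finset.sum_eq_single_of_mem ρ hρ fun τ _ hτ => by simp [sub_ne_zero.2 hτ]]
      simp [Complex.mul_conj']
    exact_mod_cast hC
  have h : ∀ x, ‖K x‖ₑ ^ 2 = ENNReal.ofReal (‖K x‖ ^ 2) := fun x => by
    rw [ENNReal.ofReal_pow (norm_nonneg _), ofReal_norm]
  change ∫⁻ x in cube n 1, ‖K x‖ₑ ^ 2 = 1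
  simp only [h]
  rw [← ofReal_integral_eq_lintegral_ofReal hint
    (Filter.Eventually.of_forall fun x => by positivity), hval, ENNReal.ofReal_one]

/-- The trilinear form is controlled by the `L²(Q)` norm of the associated trigonometric
polynomial. -/
lemma enorm_trilinear_le {n : ℕ} (A : Zn n → Zn n → ℂ) (F G : Zn n →₀ ℂ) {H : Zn n →₀ ℂ}
    (hH : ∑ ρ ∈ H.support, ‖H ρ‖ ^ 2 = 1) :
    ‖∑ μ ∈ F.support, ∑ ν ∈ G.support, A μ ν * F μ * G ν * H (μ + ν)‖ₑ ≤
      (∫⁻ x in cube n 1, ‖∑ μ ∈ F.support, ∑ ν ∈ G.support,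
        A μ ν * F μ * G ν * chr (coeZ (μ + ν)) x‖ₑ ^ 2) ^ (1 / 2 : ℝ) := by
  set P : Rn n → ℂ := fun x => ∑ μ ∈ F.support, ∑ ν ∈ G.support,
    A μ ν * F μ * G ν * chr (coeZ (μ + ν)) x with hP
  set K : Rn n → ℂ := fun x => ∑ ρ ∈ H.support, H ρ * chr (coeZ (-ρ)) x with hK
  have hKc : Continuous K :=
    continuous_finsetSum _ fun ρ _ => continuous_const.mul (continuous_chr _)
  have hPc : Continuous P :=
    continuous_finsetSum _ fun μ _ => continuous_finsetSum _ fun ν _ =>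
      continuous_const.mul (continuous_chr _)
  have hexp : ∀ x, P x * K x = ∑ μ ∈ F.support, ∑ ν ∈ G.support, ∑ ρ ∈ H.support,
      A μ ν * F μ * G ν * H ρ * chr (coeZ (μ + ν - ρ)) x := by
    intro x
    simp only [hP, Finset.sum_mul]
    refine Finset.sum_congr rfl fun μ _ => Finset.sum_congr rfl fun ν _ => ?_
    rw [hK, Finset.mul_sum]
    refine Finset.sum_congr rfl fun ρ _ => ?_
    rw [sub_eq_add_neg, coeZ_add (μ + ν), chr_add]
    ring
  have hint : ∀ (c : ℂ) (ξ : Rn n), IntegrableOn (fun x => c * chr ξ x) (cube n 1) :=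
    fun c ξ => (integrableOn_chr ξ).const_mul c
  have hval : ∫ x in cube n 1, P x * K x =
      ∑ μ ∈ F.support, ∑ ν ∈ G.support, A μ ν * F μ * G ν * H (μ + ν) := by
    simp only [hexp]
    rw [integral_finsetSum _ fun μ _ => integrable_finsetSum _ fun ν _ =>
      integrable_finsetSum _ fun ρ _ => hint _ _]
    refine Finset.sum_congr rfl fun μ _ => ?_
    rw [integral_finsetSum _ fun ν _ => integrable_finsetSum _ fun ρ _ => hint _ _]
    refine Finset.sum_congr rfl fun ν _ => ?_
    rw [integral_finsetSum _ fun ρ _ => hint _ _]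
    simp only [integral_const_mul, integral_cube_chr]
    rw [Finset.sum_eq_single (μ + ν)]
    · simp
    · intro ρ _ hρ
      simp [sub_ne_zero.2 hρ.symm]
    · intro h
      simp [Finsupp.notMem_support_iff.1 h]
  rw [← hval]
  calc ‖∫ x in cube n 1, P x * K x‖ₑ ≤ ∫⁻ x in cube n 1, ‖P x * K x‖ₑ :=
        enorm_integral_le_lintegral_enorm _
    _ = ∫⁻ x in cube n 1, ((fun x => ‖P x‖ₑ) * fun x => ‖K x‖ₑ) x := by
        simp only [enorm_mul, Pi.mul_apply]
    _ ≤ (∫⁻ x in cube n 1, ‖P x‖ₑ ^ (2 : ℝ)) ^ (1 / 2 : ℝ) *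
          (∫⁻ x in cube n 1, ‖K x‖ₑ ^ (2 : ℝ)) ^ (1 / 2 : ℝ) :=
        ENNReal.lintegral_mul_le_Lp_mul_Lq _ Real.HolderConjugate.two_two
          hPc.enorm.aemeasurable hKc.enorm.aemeasurable
    _ = (∫⁻ x in cube n 1, ‖P x‖ₑ ^ 2) ^ (1 / 2 : ℝ) := by
        simp only [ENNReal.rpow_two]
        rw [lintegral_cube_trig_sq hH]
        simp

/-- The local `L²` norm of `u P` over the unit cube is bounded below when `u` is. -/
lemma le_localL2_mul {n : ℕ} {u P : Rn n → ℂ} (hP : Continuous P) {κ : ℝ≥0∞}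
    (hu : ∀ x ∈ cube n 1, κ ≤ ‖u x‖ₑ) :
    κ * (∫⁻ x in cube n 1, ‖P x‖ₑ ^ 2) ^ (1 / 2 : ℝ) ≤ localL2 (fun x => u x * P x) 0 := by
  have hκ : κ = (κ ^ 2) ^ (1 / 2 : ℝ) := by
    rw [← ENNReal.rpow_two, ← ENNReal.rpow_mul]; norm_num
  have hm : Measurable P := hP.measurable
  rw [localL2, hκ, ← ENNReal.mul_rpow_of_nonneg _ _ (by norm_num),
    ← lintegral_const_mul _ (by fun_prop)]
  refine ENNReal.rpow_le_rpow (setLIntegral_mono' ?_ fun x hx => ?_) (by norm_num)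
  · exact MeasurableSet.univ_pi fun _ => measurableSet_Icc
  · rw [coeZ_zero, add_zero, ← mul_pow, ← enorm_eq_nnnorm, enorm_mul]
    gcongr
    exact hu x hx

/-- test-function construction giving the lower bound for the special
product bump `Φ(ξ,η) = φ(ξ)φ(η)`. -/
theorem statement17 (n : ℕ) (φ : Rn n → ℂ) (hφ : IsCcInfty φ)
    (hsupp : Function.support φ ⊆ cube n 1) (hone : ∀ ξ ∈ cube n (1 / 2), φ ξ = 1) :
    ∃ c : ℝ≥0∞, 0 < c ∧ c < ∞ ∧
      ∀ A : Zn n → Zn n → ℂ, IsLinftyMatrix A →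
        ∀ F G H : Zn n →₀ ℂ,
          (∑ μ ∈ F.support, ‖F μ‖ ^ 2 = 1) →
          (∑ ν ∈ G.support, ‖G ν‖ ^ 2 = 1) →
          (∑ ρ ∈ H.support, ‖H ρ‖ ^ 2 = 1) →
          ∃ f g : SchwartzMap (Rn n) ℂ,
            c⁻¹ ≤ eLpNorm (⇑f) 2 volume ∧ eLpNorm (⇑f) 2 volume ≤ c ∧
            c⁻¹ ≤ eLpNorm (⇑g) 2 volume ∧ eLpNorm (⇑g) 2 volume ≤ c ∧
            c⁻¹ * (‖∑ μ ∈ F.support, ∑ ν ∈ G.support,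
                A μ ν * F μ * G ν * H (μ + ν)‖₊ : ℝ≥0∞)
              ≤ amalgamNorm ⊤
                  (Tbil (sigmaA A (fun p : Rn n × Rn n => φ p.1 * φ p.2)) f g) := by
  obtain ⟨ψ, hψ, hcs, hs, hpos, hθ⟩ := exists_bump n
  have hc : Continuous ψ := hψ.continuous
  set s : ℝ≥0∞ := eLpNorm ψ 2 volume with hsdef
  set κ : ℝ≥0∞ := ENNReal.ofReal ((∫ ξ, ψ ξ) / 2) ^ 2 with hκdef
  have hs0 : s ≠ 0 := by
    intro h
    rw [hsdef, eLpNorm_eq_zero_iff hc.aestronglyMeasurable (by norm_num)] at h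
    rw [integral_congr_ae h] at hpos
    simp at hpos
  have hst : s ≠ ∞ := (hc.memLp_of_hasCompactSupport hcs).eLpNorm_ne_top
  have hκ0 : κ ≠ 0 := pow_ne_zero _ (by simpa using hpos)
  refine ⟨s + s⁻¹ + κ⁻¹, ?_, ?_, ?_⟩
  · exact pos_iff_ne_zero.2 (by simp [hs0])
  · simp [lt_top_iff_ne_top, hs0, hst, hκ0]
  have hle : s ≤ s + s⁻¹ + κ⁻¹ := le_self_add.trans le_self_add
  have hge : (s + s⁻¹ + κ⁻¹)⁻¹ ≤ s :=
    ENNReal.inv_le_iff_inv_le.2 (le_add_self.trans le_self_add)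
  have hgeκ : (s + s⁻¹ + κ⁻¹)⁻¹ ≤ κ := ENNReal.inv_le_iff_inv_le.2 le_add_self
  intro A _ F G H hF hG hH
  obtain ⟨f, hf, hfn⟩ := exists_ft_eq
    ((hasCompactSupport_comb hcs F).toSchwartzMap (contDiff_comb hψ F))
  obtain ⟨g, hg, hgn⟩ := exists_ft_eq
    ((hasCompactSupport_comb hcs G).toSchwartzMap (contDiff_comb hψ G))
  have hfs : eLpNorm (⇑f) 2 volume = s := hfn.trans (eLpNorm_comb hc hs hF)
  have hgs : eLpNorm (⇑g) 2 volume = s := hgn.trans (eLpNorm_comb hc hs hG)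
  refine ⟨f, g, hfs ▸ hge, hfs ▸ hle, hgs ▸ hge, hgs ▸ hle, ?_⟩
  have hT := funext fun x => Tbil_eq hsupp hone hc hcs hs A hf hg x
  rw [hT, amalgamNorm, if_pos rfl]
  refine le_trans ?_ (le_iSup _ (0 : Zn n))
  refine (mul_le_mul' hgeκ (enorm_trilinear_le A F G hH)).trans (le_localL2_mul ?_ fun x hx => ?_)
  · exact continuous_finsetSum _ fun μ _ => continuous_finsetSum _ fun ν _ =>
      continuous_const.mul (continuous_chr _)
  · rw [enorm_pow, ← ofReal_norm (theta ψ x)]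
    exact pow_le_pow_left' (ENNReal.ofReal_le_ofReal (hθ x hx)) 2
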